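/- Let Γ be an infinite group generated by a finite generating family S and G = Cay(Γ, S) with edge set E. Consider the free pmp action Γ ↷ ([0,1]^E, P = Leb^E) and the Γ-equivariant Borel map FMSF : [0,1]^E → {0,1}^E. If WMSF ≠ FMSF (i.e. there is an edge e with P[e ∈ FMSF(x) \ WMSF(x)] > 0), then the cluster equivalence relation R_FMSF = R^cl_{FMSF} on ([0,1]^E, P) is not hyperfinite. -/

import Mathlib

open MeasureTheory Set

noncomputable section

variable {Γ : Type} [Group Γ] {d : ℕ}

/-- The edge `(g, i)` of the Cayley graph `Cay(Γ, S)` joins `g` and `g * S i`. -/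
def Joins (S : Fin d → Γ) (e : Γ × Fin d) (u v : Γ) : Prop :=
  (u = e.1 ∧ v = e.1 * S e.2) ∨ (v = e.1 ∧ u = e.1 * S e.2)

/-- `ed`, `vs` form a simple cycle of length `n` in `Cay(Γ, S)`. -/
def IsCycle (S : Fin d → Γ) (n : ℕ) (ed : Fin n → Γ × Fin d) (vs : Fin (n + 1) → Γ) : Prop :=
  0 < n ∧ vs (Fin.last n) = vs 0 ∧
    (∀ k : Fin n, Joins S (ed k) (vs k.castSucc) (vs k.succ)) ∧
    Function.Injective (fun k : Fin n => vs k.castSucc) ∧ Function.Injective ed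

/-- `ed`, `vs` form a bi-infinite self-avoiding path in `Cay(Γ, S)`. -/
def IsBiInfPath (S : Fin d → Γ) (ed : ℤ → Γ × Fin d) (vs : ℤ → Γ) : Prop :=
  Function.Injective vs ∧ ∀ n : ℤ, Joins S (ed n) (vs n) (vs (n + 1))

/-- The free minimal spanning forest of the labeling `x`. -/
def FMSF (S : Fin d → Γ) (x : Γ × Fin d → ℝ) : Set (Γ × Fin d) :=
  {e | ∀ (n : ℕ) (ed : Fin n → Γ × Fin d) (vs : Fin (n + 1) → Γ),
    IsCycle S n ed vs → (∃ k, ed k = e) → ∃ k, ed k ≠ e ∧ x e < x (ed k)}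

/-- The wired minimal spanning forest of the labeling `x`. -/
def WMSF (S : Fin d → Γ) (x : Γ × Fin d → ℝ) : Set (Γ × Fin d) :=
  {e | (∀ (n : ℕ) (ed : Fin n → Γ × Fin d) (vs : Fin (n + 1) → Γ),
          IsCycle S n ed vs → (∃ k, ed k = e) → ∃ k, ed k ≠ e ∧ x e < x (ed k)) ∧
       (∀ (ed : ℤ → Γ × Fin d) (vs : ℤ → Γ),
          IsBiInfPath S ed vs → (∃ k, ed k = e) → ∃ k, ed k ≠ e ∧ x e < x (ed k))}

/-- `u` and `v` are connected within the subgraph whose edge set is `A`. -/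
def ConnIn (S : Fin d → Γ) (A : Set (Γ × Fin d)) (u v : Γ) : Prop :=
  Relation.ReflTransGen (fun a b => ∃ e ∈ A, Joins S e a b) u v

/-- The shift action of `Γ` on labelings `[0,1]^E`, `E = Γ × Fin d` the edge set of the
Cayley graph, induced by the left translation action of `Γ` on edges. -/
def shiftE (g : Γ) (x : Γ × Fin d → ℝ) : Γ × Fin d → ℝ := fun e => x (g⁻¹ * e.1, e.2)

/-- The cluster equivalence relation of the free minimal spanning forest:
`(x, y) ∈ R_FMSF` iff `y = g⁻¹ · x` for some `g ∈ Γ` such that `1` and `g` lie in the same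
component of the forest `FMSF(x)`. -/
def Rfmsf (S : Fin d → Γ) : Set ((Γ × Fin d → ℝ) × (Γ × Fin d → ℝ)) :=
  {q | ∃ g : Γ, q.2 = shiftE g⁻¹ q.1 ∧ ConnIn S (FMSF S q.1) 1 g}

/-- `R` is an equivalence relation, as a set of pairs. -/
def IsEquivRelSet {α : Type*} (R : Set (α × α)) : Prop :=
  (∀ x, (x, x) ∈ R) ∧ (∀ x y, (x, y) ∈ R → (y, x) ∈ R) ∧
    (∀ x y z, (x, y) ∈ R → (y, z) ∈ R → (x, z) ∈ R)

/-- A countable Borel equivalence relation is hyperfinite if it is the union of an increasing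
sequence of Borel subequivalence relations with finite classes. -/
def Hyperfinite {α : Type*} [MeasurableSpace α] (R : Set (α × α)) : Prop :=
  ∃ Rn : ℕ → Set (α × α), Monotone Rn ∧
    (∀ n, IsEquivRelSet (Rn n) ∧ MeasurableSet (Rn n) ∧
      ∀ x, {y | (x, y) ∈ Rn n}.Finite) ∧
    R = ⋃ n, Rn n

/-- `P` is the product `Leb^E` of uniform measures on `[0,1]^E`. -/
def IsProductLeb {E : Type} (P : Measure (E → ℝ)) : Prop :=
  IsProbabilityMeasure P ∧
    ∀ (s : Finset E) (t : E → Set ℝ), (∀ e, MeasurableSet (t e)) →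
      P {x | ∀ e ∈ s, x e ∈ t e} = ∏ e ∈ s, volume (t e ∩ Icc (0:ℝ) 1)

section Connectivity

lemma Joins.symm {S : Fin d → Γ} {e : Γ × Fin d} {u v : Γ} (h : Joins S e u v) :
    Joins S e v u := by
  rcases h with h | h
  · exact Or.inr h
  · exact Or.inl h

lemma joins_self (S : Fin d → Γ) (e : Γ × Fin d) : Joins S e e.1 (e.1 * S e.2) :=
  Or.inl ⟨rfl, rfl⟩

lemma Joins.mul_left {S : Fin d → Γ} {e : Γ × Fin d} {u v : Γ} (h : Joins S e u v) (g : Γ) :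
    Joins S (g * e.1, e.2) (g * u) (g * v) := by
  rcases h with ⟨rfl, rfl⟩ | ⟨rfl, rfl⟩
  · exact Or.inl ⟨rfl, by simp [mul_assoc]⟩
  · exact Or.inr ⟨rfl, by simp [mul_assoc]⟩

lemma ConnIn.symm {S : Fin d → Γ} {A : Set (Γ × Fin d)} {u v : Γ} (h : ConnIn S A u v) :
    ConnIn S A v u := by
  induction h with
  | refl => exact Relation.ReflTransGen.refl
  | tail _ h ih =>
    obtain ⟨e, he, hj⟩ := h
    exact Relation.ReflTransGen.head ⟨e, he, hj.symm⟩ ih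

lemma ConnIn.of_joins {S : Fin d → Γ} {A : Set (Γ × Fin d)} {e : Γ × Fin d} {u v : Γ}
    (he : e ∈ A) (h : Joins S e u v) : ConnIn S A u v :=
  Relation.ReflTransGen.single ⟨e, he, h⟩

lemma ConnIn.mul_left {S : Fin d → Γ} {A B : Set (Γ × Fin d)} {u v : Γ}
    (h : ConnIn S A u v) (g : Γ) (hAB : ∀ e ∈ A, (g * e.1, e.2) ∈ B) :
    ConnIn S B (g * u) (g * v) :=
  Relation.ReflTransGen.lift (g * ·) (fun _ _ ⟨e, he, hj⟩ => ⟨_, hAB e he, hj.mul_left g⟩) _ _ h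

lemma connIn_mul_left_iff {S : Fin d → Γ} {A B : Set (Γ × Fin d)} {u v : Γ} (g : Γ)
    (hAB : ∀ e, (g * e.1, e.2) ∈ B ↔ e ∈ A) :
    ConnIn S B (g * u) (g * v) ↔ ConnIn S A u v := by
  refine ⟨fun h => ?_, fun h => h.mul_left g fun e he => (hAB e).2 he⟩
  have := h.mul_left (B := A) g⁻¹ fun e he => by
    rw [← hAB]; simpa using he
  simpa using this

/-- Membership in a vertex set without crossing edges in `A` is preserved along `A`. -/
lemma ConnIn.mem_iff {S : Fin d → Γ} {A : Set (Γ × Fin d)} {K : Set Γ} {u v : Γ}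
    (h : ConnIn S A u v) (hK : ∀ e ∈ A, e.1 ∈ K ↔ e.1 * S e.2 ∈ K) : u ∈ K ↔ v ∈ K := by
  induction h with
  | refl => rfl
  | tail _ h ih =>
    obtain ⟨e, he, ⟨rfl, rfl⟩ | ⟨rfl, rfl⟩⟩ := h
    · exact ih.trans (hK e he)
    · exact ih.trans (hK e he).symm

/-- Connected vertices are joined by a simple path. -/
lemma ConnIn.exists_path {S : Fin d → Γ} {A : Set (Γ × Fin d)} {u v : Γ} (h : ConnIn S A u v) :
    ∃ (n : ℕ) (vs : ℕ → Γ), vs 0 = u ∧ vs n = v ∧ Set.InjOn vs {k | k ≤ n} ∧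
      ∀ k < n, ∃ e ∈ A, Joins S e (vs k) (vs (k + 1)) := by
  let G : SimpleGraph Γ := SimpleGraph.fromRel fun a b => ∃ e ∈ A, Joins S e a b
  have hG : G.Reachable u v := by
    induction h with
    | refl => rfl
    | @tail b c _ h ih =>
      by_cases hbc : b = c
      · exact hbc ▸ ih
      · exact ih.trans (SimpleGraph.Adj.reachable ⟨hbc, Or.inl h⟩)
  classical
  obtain ⟨p⟩ := hG
  refine ⟨p.toPath.1.length, p.toPath.1.getVert, by simp, by simp,
    p.toPath.2.getVert_injOn, fun k hk => ?_⟩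
  obtain ⟨-, h | ⟨e, he, hj⟩⟩ := p.toPath.1.adj_getVert_succ hk
  · exact h
  · exact ⟨e, he, hj.symm⟩

lemma connIn_of_chain {S : Fin d → Γ} {A : Set (Γ × Fin d)} {vs : ℕ → Γ} {a b : ℕ} (hab : a ≤ b)
    (h : ∀ k, a ≤ k → k < b → ∃ e ∈ A, Joins S e (vs k) (vs (k + 1))) :
    ConnIn S A (vs a) (vs b) := by
  induction b, hab using Nat.le_induction with
  | base => exact Relation.ReflTransGen.refl
  | succ b hab ih =>
    exact (ih fun k h1 h2 => h k h1 (by omega)).tail (h b hab (by omega))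

lemma Joins.endpoints {S : Fin d → Γ} {e : Γ × Fin d} {u v u' v' : Γ} (h : Joins S e u v)
    (h' : Joins S e u' v') : (u = u' ∧ v = v') ∨ (u = v' ∧ v = u') := by
  rcases h with ⟨rfl, rfl⟩ | ⟨rfl, rfl⟩ <;> rcases h' with ⟨rfl, rfl⟩ | ⟨rfl, rfl⟩ <;> simp

end Connectivity

section Forests

/-- The edges whose label is smaller than that of `e`. -/
def below (x : Γ × Fin d → ℝ) (e : Γ × Fin d) : Set (Γ × Fin d) := {e' | x e' < x e}

/-- The edges whose endpoints are not connected by edges of smaller label. -/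
def freeForest (S : Fin d → Γ) (x : Γ × Fin d → ℝ) : Set (Γ × Fin d) :=
  {e | ¬ ConnIn S (below x e) e.1 (e.1 * S e.2)}

/-- The edges of `freeForest` one of whose endpoints lies in a finite cluster of the edges of
smaller label. -/
def wiredForest (S : Fin d → Γ) (x : Γ × Fin d → ℝ) : Set (Γ × Fin d) :=
  {e | e ∈ freeForest S x ∧ ({v | ConnIn S (below x e) e.1 v}.Finite ∨
    {v | ConnIn S (below x e) (e.1 * S e.2) v}.Finite)}

lemma FMSF_subset_freeForest (S : Fin d → Γ) (x : Γ × Fin d → ℝ) :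
    FMSF S x ⊆ freeForest S x := by
  intro e he hc
  obtain ⟨n, vs, h0, hn, hinj, hed⟩ := hc.exists_path
  have : Nonempty (Γ × Fin d) := ⟨e⟩
  choose! ed hA hJ using hed
  have hne : ∀ k < n, ed k ≠ e := fun k hk h => by
    have : x (ed k) < x e := hA k hk
    rw [h] at this
    exact lt_irrefl _ this
  have hcyc : IsCycle S (n + 1) (fun k => if (k : ℕ) < n then ed k else e)
      (fun k => if (k : ℕ) ≤ n then vs k else e.1) := by
    refine ⟨by omega, by simp [h0], fun k => ?_, fun k l hkl => ?_, fun k l hkl => ?_⟩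
    · have hk := k.2
      by_cases hkn : (k : ℕ) < n
      · simpa [hkn, hkn.le] using hJ k hkn
      · have : (k : ℕ) = n := by omega
        simpa [this, hn] using (joins_self S e).symm
    · have hk : (k : ℕ) ≤ n := by omega
      have hl : (l : ℕ) ≤ n := by omega
      simp only [Fin.val_castSucc, hk, hl, if_true] at hkl
      exact Fin.ext (hinj hk hl hkl)
    · have hk := k.2
      have hl := l.2
      by_cases hkn : (k : ℕ) < n <;> by_cases hln : (l : ℕ) < n <;>
        simp only [hkn, hln, if_true, if_false] at hkl
      · have h1 := hJ k hkn
        rw [hkl] at h1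
        rcases h1.endpoints (hJ l hln) with ⟨h, -⟩ | ⟨h, h'⟩
        · exact Fin.ext (hinj hkn.le hln.le h)
        · have h2 := hinj (show (k : ℕ) ≤ n by omega) (show (l : ℕ) + 1 ≤ n by omega) h
          have h3 := hinj (show (k : ℕ) + 1 ≤ n by omega) (show (l : ℕ) ≤ n by omega) h'
          omega
      · exact absurd hkl (hne _ hkn)
      · exact absurd hkl.symm (hne _ hln)
      · exact Fin.ext (by omega)
  obtain ⟨k, hk, hlt⟩ := he _ _ _ hcyc ⟨Fin.last n, by simp⟩
  by_cases hkn : (k : ℕ) < n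
  · simp only [hkn, if_true] at hlt
    exact lt_asymm hlt (hA k hkn)
  · simp [hkn] at hk

lemma freeForest_subset_FMSF (S : Fin d → Γ) {x : Γ × Fin d → ℝ} (hx : Function.Injective x) :
    freeForest S x ⊆ FMSF S x := by
  rintro e he n ed vs ⟨hn, hclose, hJ, -, hinj⟩ ⟨k, rfl⟩
  by_contra! hcon
  apply he
  have hlt : ∀ j, j ≠ k → ed j ∈ below x (ed k) := fun j hj =>
    lt_of_le_of_ne (hcon j fun h => hj (hinj h)) fun h => hj (hinj (hx h))
  let ws : ℕ → Γ := fun j => vs (Fin.ofNat (n + 1) j)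
  have hstep : ∀ j (hj : j < n), Joins S (ed ⟨j, hj⟩) (ws j) (ws (j + 1)) := fun j hj => by
    have := hJ ⟨j, hj⟩
    convert this using 2
    · ext; simp; omega
    · ext; simp; omega
  have h1 : ConnIn S (below x (ed k)) (ws 0) (ws k) :=
    connIn_of_chain (Nat.zero_le _) fun j _ hj =>
      ⟨ed ⟨j, by omega⟩, hlt _ fun h => by simp [← h] at hj, hstep j _⟩
  have h2 : ConnIn S (below x (ed k)) (ws (k + 1)) (ws n) :=
    connIn_of_chain (by omega) fun j hj hjn =>
      ⟨ed ⟨j, hjn⟩, hlt _ fun h => by simp [← h] at hj, hstep j _⟩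
  have h3 : ws n = ws 0 := by
    have e1 : Fin.ofNat (n + 1) n = Fin.last n := by ext; simp
    have e2 : Fin.ofNat (n + 1) 0 = 0 := by ext; simp
    simp only [ws, e1, e2, hclose]
  have h4 : ConnIn S (below x (ed k)) (ws (k + 1)) (ws k) := h2.trans (h3 ▸ h1)
  rcases (joins_self S (ed k)).endpoints (hstep k k.2) with ⟨h, h'⟩ | ⟨h, h'⟩
  · rw [h', h]; exact h4.symm
  · rw [h', h]; exact h4

lemma not_mem_wiredForest (S : Fin d → Γ) {x : Γ × Fin d → ℝ} (hx : Function.Injective x)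
    {e : Γ × Fin d} (he : e ∈ FMSF S x) (hw : e ∉ WMSF S x) : e ∉ wiredForest S x := by
  have hb : ∃ ed vs, IsBiInfPath S ed vs ∧ (∃ k, ed k = e) ∧ ∀ k, ed k ≠ e → x (ed k) ≤ x e := by
    by_contra! hcon
    exact hw ⟨he, fun ed vs h1 h2 => hcon ed vs h1 h2⟩
  obtain ⟨ed, vs, ⟨hinj, hJ⟩, ⟨k, rfl⟩, hle⟩ := hb
  have hne : ∀ j, j ≠ k → ed j ∈ below x (ed k) := fun j hj => by
    have hej : ed j ≠ ed k := fun h => by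
      have h1 := hJ j
      rw [h] at h1
      rcases h1.endpoints (hJ k) with ⟨h, -⟩ | ⟨h, h'⟩
      · exact hj (hinj h)
      · have h2 := hinj h
        have h3 := hinj h'
        omega
    exact lt_of_le_of_ne (hle j hej) fun h => hej (hx h)
  have hpos : {v | ConnIn S (below x (ed k)) (vs (k + 1)) v}.Infinite := by
    refine Set.infinite_of_injective_forall_mem (f := fun n : ℕ => vs (k + 1 + n))
      (fun a b h => by have := hinj h; omega) fun n => ?_
    have := connIn_of_chain (S := S) (A := below x (ed k)) (vs := fun n : ℕ => vs (k + 1 + n))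
      (Nat.zero_le n) fun j _ _ => ⟨ed (k + 1 + j), hne _ (by omega), by
        have := hJ (k + 1 + j)
        rwa [add_assoc (k + 1)] at this⟩
    simpa using this
  have hneg : {v | ConnIn S (below x (ed k)) (vs k) v}.Infinite := by
    refine Set.infinite_of_injective_forall_mem (f := fun n : ℕ => vs (k - n))
      (fun a b h => by have := hinj h; omega) fun n => ?_
    have := connIn_of_chain (S := S) (A := below x (ed k)) (vs := fun n : ℕ => vs (k - n))
      (Nat.zero_le n) fun j _ _ => ⟨ed (k - (j + 1)), hne _ (by omega), by
        have := (hJ (k - (j + 1))).symm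
        convert this using 2
        all_goals
          push_cast
          ring⟩
    simpa using this
  rintro ⟨-, hfin⟩
  rcases (joins_self S (ed k)).endpoints (hJ k) with ⟨h, h'⟩ | ⟨h, h'⟩ <;> rw [h', h] at hfin
  · exact hfin.elim hneg hpos
  · exact hfin.elim hpos hneg

/-- The clusters of the wired forest are infinite. -/
lemma infinite_cluster_wiredForest [Infinite Γ] {S : Fin d → Γ}
    (hgen : Subgroup.closure (Set.range S) = ⊤) (x : Γ × Fin d → ℝ) (v : Γ) :
    {w | ConnIn S (wiredForest S x) v w}.Infinite := by
  intro hK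
  set K := {w | ConnIn S (wiredForest S x) v w} with hKdef
  have hv : v ∈ K := Relation.ReflTransGen.refl
  let B : Set (Γ × Fin d) := {e | ¬ (e.1 ∈ K ↔ e.1 * S e.2 ∈ K)}
  have hBfin : B.Finite := by
    have h1 : ((fun p : Γ × Fin d => p) '' (K ×ˢ univ)).Finite := (hK.prod finite_univ).image _
    have h2 : ((fun p : Γ × Fin d => (p.1 * (S p.2)⁻¹, p.2)) '' (K ×ˢ univ)).Finite :=
      (hK.prod finite_univ).image _
    refine (h1.union h2).subset fun e he => ?_
    by_cases h : e.1 ∈ K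
    · exact Or.inl ⟨e, ⟨h, mem_univ _⟩, rfl⟩
    · refine Or.inr ⟨(e.1 * S e.2, e.2), ⟨?_, mem_univ _⟩, by simp⟩
      by_contra h'
      exact he (iff_of_false h h')
  have hBne : B.Nonempty := by
    by_contra hempty
    rw [Set.not_nonempty_iff_eq_empty] at hempty
    have hcl : ∀ (g : Γ) (i : Fin d), g ∈ K ↔ g * S i ∈ K := fun g i => by
      by_contra h
      have : (g, i) ∈ B := h
      simp [hempty] at this
    have hall : ∀ g ∈ Subgroup.closure (Set.range S), ∀ h, h ∈ K ↔ h * g ∈ K := by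
      intro g hg
      induction hg using Subgroup.closure_induction with
      | mem g hg => obtain ⟨i, rfl⟩ := hg; exact fun h => hcl h i
      | one => simp
      | mul a b _ _ ha hb => intro h; rw [ha, hb, mul_assoc]
      | inv a _ ha => intro h; rw [ha (h * a⁻¹)]; simp
    refine Set.infinite_univ (hK.subset fun g _ => ?_)
    have := (hall (v⁻¹ * g) (hgen ▸ Subgroup.mem_top _) v).1 hv
    simpa using this
  obtain ⟨e, heB, hmin⟩ := Set.exists_min_image B x hBfin hBne
  have hcross : ∀ e' ∈ below x e, e'.1 ∈ K ↔ e'.1 * S e'.2 ∈ K := fun e' he' => by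
    by_contra h
    exact absurd (hmin e' h) (not_le.2 he')
  have hfree : e ∈ freeForest S x := fun hc => heB (hc.mem_iff hcross)
  have hW : e ∈ wiredForest S x := by
    refine ⟨hfree, ?_⟩
    by_cases h : e.1 ∈ K
    · exact Or.inl (hK.subset fun w hw => (ConnIn.mem_iff hw hcross).1 h)
    · refine Or.inr (hK.subset fun w hw => (ConnIn.mem_iff hw hcross).1 ?_)
      by_contra h'
      exact heB (iff_of_false h h')
  refine heB ⟨fun h => ?_, fun h => ?_⟩
  · exact Relation.ReflTransGen.trans h (ConnIn.of_joins hW (joins_self S e))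
  · exact Relation.ReflTransGen.trans h (ConnIn.of_joins hW (joins_self S e).symm)

/-- A finite set of edges of the free forest spanned by `K` has at most `K.card` elements. -/
lemma card_le_of_subset_freeForest {S : Fin d → Γ} {x : Γ × Fin d → ℝ}
    (hx : Function.Injective x) (K : Finset Γ) (D : Finset (Γ × Fin d))
    (hD : ∀ e ∈ D, e ∈ freeForest S x ∧ e.1 ∈ K ∧ e.1 * S e.2 ∈ K) : D.card ≤ K.card := by
  classical
  let b : D → (K → ℝ) := fun e k =>
    (if (k : Γ) = e.1.1 then 1 else 0) - (if (k : Γ) = e.1.1 * S e.1.2 then 1 else 0)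
  have hb : LinearIndependent ℝ b := by
    rw [linearIndependent_iff']
    intro s c hsum
    by_contra! hne
    have hT : (s.filter fun e => c e ≠ 0).Nonempty := by
      obtain ⟨e, he, hce⟩ := hne
      exact ⟨e, by simp [he, hce]⟩
    obtain ⟨e, he, hmax⟩ := Finset.exists_max_image _ (fun e : D => x e.1) hT
    rw [Finset.mem_filter] at he
    let C : Set Γ := {w | ConnIn S (below x e.1) e.1.1 w}
    let φ : (K → ℝ) → ℝ := fun f => ∑ k : K, if (k : Γ) ∈ C then f k else 0
    have hφb : ∀ e' : D, φ (b e') =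
        (if e'.1.1 ∈ C then 1 else 0) - (if e'.1.1 * S e'.1.2 ∈ C then 1 else 0) := by
      intro e'
      have key : ∀ g ∈ K, (∑ k : K, if (k : Γ) ∈ C then (if (k : Γ) = g then (1 : ℝ) else 0) else 0)
          = if g ∈ C then 1 else 0 := by
        intro g hg
        rw [Finset.sum_eq_single ⟨g, hg⟩]
        · simp
        · rintro k - hk
          have : (k : Γ) ≠ g := fun h => hk (Subtype.ext h)
          simp [this]
        · simp
      rw [← key _ (hD _ e'.2).2.1, ← key _ (hD _ e'.2).2.2, ← Finset.sum_sub_distrib]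
      refine Finset.sum_congr rfl fun k _ => ?_
      by_cases hk : (k : Γ) ∈ C <;> simp [hk, b]
    have hφsum : φ (∑ i ∈ s, c i • b i) = ∑ i ∈ s, c i * φ (b i) := by
      simp only [φ, Finset.sum_apply, Pi.smul_apply, smul_eq_mul, Finset.mul_sum]
      rw [Finset.sum_comm]
      refine Finset.sum_congr rfl fun k _ => ?_
      by_cases hk : (k : Γ) ∈ C <;> simp [hk]
    have hzero : φ (∑ i ∈ s, c i • b i) = 0 := by
      rw [hsum]; simp [φ]
    rw [hφsum, Finset.sum_eq_single e] at hzero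
    · have h1 : e.1.1 ∈ C := Relation.ReflTransGen.refl
      have h2 : e.1.1 * S e.1.2 ∉ C := (hD _ e.2).1
      rw [hφb] at hzero
      simp [h1, h2, he.2] at hzero
    · intro e' he's hne'
      by_cases hc : c e' = 0
      · simp [hc]
      · have hlt : e'.1 ∈ below x e.1 := lt_of_le_of_ne
          (hmax e' (by simp [he's, hc])) fun h => hne' (Subtype.ext (hx h))
        have hiff : e'.1.1 ∈ C ↔ e'.1.1 * S e'.1.2 ∈ C :=
          ⟨fun h => Relation.ReflTransGen.trans h (ConnIn.of_joins hlt (joins_self S _)),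
            fun h => Relation.ReflTransGen.trans h (ConnIn.of_joins hlt (joins_self S _).symm)⟩
        rw [hφb]
        simp [hiff]
    · intro h
      exact absurd he.1 h
  have := hb.fintype_card_le_finrank
  simpa using this

end Forests

section Equivariance

lemma shiftE_shiftE (g h : Γ) (x : Γ × Fin d → ℝ) :
    shiftE g (shiftE h x) = shiftE (g * h) x := by
  ext e
  simp [shiftE, mul_assoc]

lemma shiftE_one (x : Γ × Fin d → ℝ) : shiftE 1 x = x := by
  ext e
  simp [shiftE]

/-- A family of edge sets, depending on the labeling, that commutes with translations. -/
def Equivariant (A : (Γ × Fin d → ℝ) → Set (Γ × Fin d)) : Prop :=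
  ∀ g x e, (g * e.1, e.2) ∈ A (shiftE g x) ↔ e ∈ A x

lemma Equivariant.connIn_iff {S : Fin d → Γ} {A : (Γ × Fin d → ℝ) → Set (Γ × Fin d)}
    (hA : Equivariant A) (g : Γ) (x : Γ × Fin d → ℝ) (u v : Γ) :
    ConnIn S (A (shiftE g x)) (g * u) (g * v) ↔ ConnIn S (A x) u v :=
  connIn_mul_left_iff g (hA g x)

lemma mem_below_shiftE (g : Γ) (x : Γ × Fin d → ℝ) (e e' : Γ × Fin d) :
    (g * e'.1, e'.2) ∈ below (shiftE g x) (g * e.1, e.2) ↔ e' ∈ below x e := by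
  simp [below, shiftE]

lemma equivariant_freeForest (S : Fin d → Γ) : Equivariant (freeForest S) := by
  intro g x e
  simp only [freeForest, Set.mem_ofPred_eq, mul_assoc]
  rw [connIn_mul_left_iff g (mem_below_shiftE g x e)]

lemma equivariant_wiredForest (S : Fin d → Γ) : Equivariant (wiredForest S) := by
  intro g x e
  have key : ∀ u, {v | ConnIn S (below (shiftE g x) (g * e.1, e.2)) (g * u) v}.Finite ↔
      {v | ConnIn S (below x e) u v}.Finite := by
    intro u
    have : {v | ConnIn S (below (shiftE g x) (g * e.1, e.2)) (g * u) v} =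
        (g * ·) '' {v | ConnIn S (below x e) u v} := by
      ext v
      constructor
      · intro h
        refine ⟨g⁻¹ * v, ?_, by simp⟩
        rw [Set.mem_ofPred_eq, ← connIn_mul_left_iff g (mem_below_shiftE g x e)]
        simpa using h
      · rintro ⟨w, hw, rfl⟩
        exact (connIn_mul_left_iff g (mem_below_shiftE g x e)).2 hw
    rw [this, Set.finite_image_iff (mul_right_injective g).injOn]
  have hfree := equivariant_freeForest S g x e
  have h1 := key e.1
  have h2 := key (e.1 * S e.2)
  rw [← mul_assoc] at h2
  simp only [wiredForest, Set.mem_ofPred_eq, hfree, h1, h2]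

end Equivariance

section Measurability

lemma measurable_shiftE (g : Γ) : Measurable (shiftE (d := d) g) :=
  measurable_pi_lambda _ fun _ => measurable_pi_apply _

lemma measurableSet_reflTransGen {α V : Type*} [MeasurableSpace α] [Countable V]
    {r : α → V → V → Prop} (hr : ∀ a b, MeasurableSet {x | r x a b}) (u v : V) :
    MeasurableSet {x | Relation.ReflTransGen (r x) u v} := by
  let L : ℕ → V → Set α := fun n => Nat.rec (fun w => {_x | u = w})
    (fun _ L w => ⋃ b, L b ∩ {x | r x b w}) n
  have hL : ∀ n w, MeasurableSet (L n w) := by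
    intro n
    induction n with
    | zero => exact fun w => MeasurableSet.const _
    | succ n ih => exact fun w => MeasurableSet.iUnion fun b => (ih b).inter (hr b w)
  have : {x | Relation.ReflTransGen (r x) u v} = ⋃ n, L n v := by
    ext x
    simp only [Set.mem_ofPred_eq, Set.mem_iUnion]
    constructor
    · intro h
      induction h with
      | refl => exact ⟨0, rfl⟩
      | tail _ h ih =>
        obtain ⟨n, hn⟩ := ih
        exact ⟨n + 1, Set.mem_iUnion.2 ⟨_, hn, h⟩⟩
    · rintro ⟨n, hn⟩
      induction n generalizing v with
      | zero => exact (show u = v from hn) ▸ Relation.ReflTransGen.refl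
      | succ n ih =>
        obtain ⟨b, hb, hr'⟩ := Set.mem_iUnion.1 hn
        exact (ih b hb).tail hr'
  rw [this]
  exact MeasurableSet.iUnion fun n => hL n v

variable [Countable Γ]

lemma measurableSet_connIn {α : Type*} [MeasurableSpace α] (S : Fin d → Γ)
    {A : α → Set (Γ × Fin d)} (hA : ∀ e, MeasurableSet {x | e ∈ A x}) (u v : Γ) :
    MeasurableSet {x | ConnIn S (A x) u v} := by
  refine measurableSet_reflTransGen (fun a b => ?_) u v
  have : {x | ∃ e ∈ A x, Joins S e a b} = ⋃ e, {x | e ∈ A x} ∩ {_x | Joins S e a b} := by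
    ext x; simp
  rw [this]
  exact MeasurableSet.iUnion fun e => (hA e).inter (MeasurableSet.const _)

omit [Group Γ] [Countable Γ] in
lemma measurableSet_mem_below (e e' : Γ × Fin d) :
    MeasurableSet {x : Γ × Fin d → ℝ | e' ∈ below x e} :=
  measurableSet_lt (measurable_pi_apply _) (measurable_pi_apply _)

lemma measurableSet_mem_freeForest (S : Fin d → Γ) (e : Γ × Fin d) :
    MeasurableSet {x : Γ × Fin d → ℝ | e ∈ freeForest S x} :=
  (measurableSet_connIn S (measurableSet_mem_below e) _ _).compl

lemma measurableSet_mem_wiredForest (S : Fin d → Γ) (e : Γ × Fin d) :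
    MeasurableSet {x : Γ × Fin d → ℝ | e ∈ wiredForest S x} := by
  have key : ∀ u, MeasurableSet
      {x : Γ × Fin d → ℝ | {v | ConnIn S (below x e) u v}.Finite} := by
    intro u
    have : {x : Γ × Fin d → ℝ | {v | ConnIn S (below x e) u v}.Finite} =
        ⋃ s : Finset Γ, ⋂ v, {x | ConnIn S (below x e) u v → v ∈ s} := by
      ext x
      simp only [Set.mem_ofPred_eq, Set.mem_iUnion, Set.mem_iInter]
      exact ⟨fun h => ⟨h.toFinset, fun v hv => h.mem_toFinset.2 hv⟩,
        fun ⟨s, hs⟩ => s.finite_toSet.subset hs⟩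
    rw [this]
    exact MeasurableSet.iUnion fun s => MeasurableSet.iInter fun v =>
      (measurableSet_connIn S (measurableSet_mem_below e) _ _).imp (MeasurableSet.const _)
  exact (measurableSet_mem_freeForest S e).inter ((key _).union (key _))

end Measurability

section ProductMeasure

lemma IsProductLeb.eq_infinitePi {E : Type} {P : Measure (E → ℝ)} (hP : IsProductLeb P)  :
    P = Measure.infinitePi fun _ => volume.restrict (Icc (0 : ℝ) 1) := by
  have : IsProbabilityMeasure (volume.restrict (Icc (0 : ℝ) 1)) := ⟨by simp⟩
  refine Measure.eq_infinitePi _ fun s t ht => ?_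
  have := hP.2 s t ht
  simp only [Measure.restrict_apply (ht _)]
  exact this

lemma IsProductLeb.measurePreserving_shiftE {P : Measure (Γ × Fin d → ℝ)} (hP : IsProductLeb P)
    (g : Γ) : MeasurePreserving (shiftE g) P P := by
  refine ⟨measurable_shiftE g, ?_⟩
  have hQ : IsProductLeb (P.map (shiftE g)) := by
    have := hP.1
    refine ⟨Measure.isProbabilityMeasure_map (measurable_shiftE g).aemeasurable, fun s t ht => ?_⟩
    let σ : Γ × Fin d ↪ Γ × Fin d := ⟨fun e => (g⁻¹ * e.1, e.2), fun e e' h => by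
      simpa [Prod.ext_iff] using h⟩
    have hσ : ∀ e, σ e = (g⁻¹ * e.1, e.2) := fun _ => rfl
    have hm : MeasurableSet {x : Γ × Fin d → ℝ | ∀ e ∈ s, x e ∈ t e} :=
      MeasurableSet.pi s.countable_toSet fun e _ => ht e
    rw [Measure.map_apply (measurable_shiftE g) hm]
    have h2 := hP.2 (s.map σ) (fun e => t (g * e.1, e.2)) fun e => ht _
    have h3 : {x : Γ × Fin d → ℝ | ∀ e ∈ s.map σ, x e ∈ t (g * e.1, e.2)} =
        shiftE g ⁻¹' {x | ∀ e ∈ s, x e ∈ t e} := by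
      ext x
      simp only [Set.mem_ofPred_eq, Set.mem_preimage, Finset.mem_map, forall_exists_index, and_imp,
        forall_apply_eq_imp_iff₂]
      simp [hσ, shiftE]
    rw [← h3, h2, Finset.prod_map]
    simp [hσ]
  rw [hQ.eq_infinitePi, ← hP.eq_infinitePi]

lemma IsProductLeb.ae_mem_Icc {E : Type} {P : Measure (E → ℝ)} (hP : IsProductLeb P) (e : E) :
    ∀ᵐ x ∂P, x e ∈ Icc (0 : ℝ) 1 := by
  have := hP.1
  have h := hP.2 {e} (fun _ => Icc 0 1) fun _ => measurableSet_Icc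
  simp only [Finset.mem_singleton, forall_eq, Finset.prod_singleton, inter_self, Real.volume_Icc,
    sub_zero, ENNReal.ofReal_one] at h
  exact (prob_compl_eq_zero_iff (measurable_pi_apply e measurableSet_Icc)).2 h

lemma IsProductLeb.ae_injective {E : Type} [Countable E] {P : Measure (E → ℝ)}
    (hP : IsProductLeb P) : ∀ᵐ x ∂P, Function.Injective x := by
  have hpair : ∀ e f : E, e ≠ f → ∀ᵐ x ∂P, x e ≠ x f := by
    classical
    intro e f hef
    have hmap : (volume.restrict (Icc (0 : ℝ) 1)).prod (volume.restrict (Icc (0 : ℝ) 1)) =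
        P.map fun x => (x e, x f) := by
      refine Measure.prod_eq fun s t hs ht => ?_
      rw [Measure.map_apply (by fun_prop) (hs.prod ht), Measure.restrict_apply hs,
        Measure.restrict_apply ht]
      have h := hP.2 {e, f} (fun a => if a = e then s else t) fun a => by split_ifs <;> assumption
      have h2 : {x : E → ℝ | ∀ a ∈ ({e, f} : Finset E), x a ∈ if a = e then s else t} =
          (fun x => (x e, x f)) ⁻¹' s ×ˢ t := by
        ext x; simp [hef.symm]
      rw [h2, Finset.prod_pair hef] at h
      simpa [hef.symm] using h
    have hdiag : P.map (fun x => (x e, x f)) {p : ℝ × ℝ | p.1 = p.2} = 0 := by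
      rw [← hmap, Measure.measure_prod_null (measurableSet_eq_fun measurable_fst measurable_snd)]
      refine Filter.Eventually.of_forall fun y => ?_
      have : Prod.mk y ⁻¹' {p : ℝ × ℝ | p.1 = p.2} = {y} := by
        ext z; simp [eq_comm]
      simp [this]
    rw [Measure.map_apply (by fun_prop) (measurableSet_eq_fun measurable_fst measurable_snd)]
      at hdiag
    rw [ae_iff]
    simpa using hdiag
  have hall : ∀ᵐ x ∂P, ∀ e f : E, e ≠ f → x e ≠ x f := by
    simp only [ae_all_iff]
    exact fun e f hef => hpair e f hef
  filter_upwards [hall] with x hx e f h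
  by_contra hef
  exact hx e f hef h

end ProductMeasure

section MassTransport

variable [Countable Γ] {P : Measure (Γ × Fin d → ℝ)}

lemma mass_transport (hinv : ∀ g : Γ, MeasurePreserving (shiftE g) P P)
    {φ : Γ → (Γ × Fin d → ℝ) → ENNReal} (hφ : ∀ g, Measurable (φ g)) :
    ∫⁻ x, ∑' g, φ g x ∂P = ∫⁻ x, ∑' g, φ g⁻¹ (shiftE g⁻¹ x) ∂P := by
  rw [lintegral_tsum fun g => (hφ g).aemeasurable,
    lintegral_tsum (f := fun g x => φ g⁻¹ (shiftE g⁻¹ x))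
      fun g => ((hφ g⁻¹).comp (measurable_shiftE g⁻¹)).aemeasurable,
    ← (Equiv.inv Γ).tsum_eq]
  exact tsum_congr fun g => ((hinv g⁻¹).lintegral_comp (hφ g⁻¹)).symm

/-- The vertices at distance at most `k` from `M` in the graph with edge set `A`. -/
def nbhd (S : Fin d → Γ) (A : Set (Γ × Fin d)) (M : Set Γ) : ℕ → Set Γ
  | 0 => M
  | k + 1 => {v | v ∈ nbhd S A M k ∨ ∃ e ∈ A, ∃ w, Joins S e v w ∧ w ∈ nbhd S A M k}

omit [Countable Γ] in
lemma nbhd_mono (S : Fin d → Γ) (A : Set (Γ × Fin d)) (M : Set Γ) : Monotone (nbhd S A M) :=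
  monotone_nat_of_le_succ fun _ _ h => Or.inl h

omit [Countable Γ] in
lemma mul_mem_nbhd_iff (S : Fin d → Γ) {A B : Set (Γ × Fin d)} {M N : Set Γ} (g : Γ)
    (hA : ∀ e, (g * e.1, e.2) ∈ B ↔ e ∈ A) (hM : ∀ v, g * v ∈ N ↔ v ∈ M) (k : ℕ) (v : Γ) :
    g * v ∈ nbhd S B N k ↔ v ∈ nbhd S A M k := by
  induction k generalizing v with
  | zero => exact hM v
  | succ k ih =>
    refine or_congr (ih v) ⟨?_, ?_⟩
    · rintro ⟨e, he, w, hJ, hw⟩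
      refine ⟨(g⁻¹ * e.1, e.2), ?_, g⁻¹ * w, ?_, ?_⟩
      · rw [← hA]; simpa using he
      · simpa using hJ.mul_left g⁻¹
      · rw [← ih]; simpa using hw
    · rintro ⟨e, he, w, hJ, hw⟩
      exact ⟨_, (hA e).2 he, _, hJ.mul_left g, (ih w).2 hw⟩

omit [Countable Γ] in
lemma exists_mem_nbhd {S : Fin d → Γ} {A : Set (Γ × Fin d)} {M : Set Γ} {v w : Γ}
    (h : ConnIn S A v w) (hw : w ∈ M) : ∃ k, v ∈ nbhd S A M k := by
  induction h using Relation.ReflTransGen.head_induction_on with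
  | refl => exact ⟨0, hw⟩
  | head h _ ih =>
    obtain ⟨e, he, hJ⟩ := h
    obtain ⟨k, hk⟩ := ih
    exact ⟨k + 1, Or.inr ⟨e, he, _, hJ, hk⟩⟩

lemma measurableSet_mem_nbhd {α : Type*} [MeasurableSpace α] (S : Fin d → Γ)
    {A : α → Set (Γ × Fin d)} {M : α → Set Γ} (hA : ∀ e, MeasurableSet {x | e ∈ A x})
    (hM : ∀ v, MeasurableSet {x | v ∈ M x}) (k : ℕ) (v : Γ) :
    MeasurableSet {x | v ∈ nbhd S (A x) (M x) k} := by
  induction k generalizing v with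
  | zero => exact hM v
  | succ k ih =>
    refine (ih v).union (s₂ := {x | ∃ e ∈ A x, ∃ w, Joins S e v w ∧ w ∈ nbhd S (A x) (M x) k}) ?_
    have : {x | ∃ e ∈ A x, ∃ w, Joins S e v w ∧ w ∈ nbhd S (A x) (M x) k} =
        ⋃ e, {x | e ∈ A x} ∩ ⋃ w, {_x | Joins S e v w} ∩ {x | w ∈ nbhd S (A x) (M x) k} := by
      ext x; simp
    rw [this]
    exact MeasurableSet.iUnion fun e => (hA e).inter <| MeasurableSet.iUnion fun w =>
      (MeasurableSet.const _).inter (ih w)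

/-- If every cluster of `A` meets `M`, then assigning to each vertex outside `M` an edge of `A`
that leads closer to `M` bounds from below the mean number of edges of `A` per vertex. -/
lemma one_le_measure_add_sum [IsProbabilityMeasure P]
    (hinv : ∀ g : Γ, MeasurePreserving (shiftE g) P P) (S : Fin d → Γ)
    {A : (Γ × Fin d → ℝ) → Set (Γ × Fin d)} (hA : Equivariant A)
    (hAm : ∀ e, MeasurableSet {x | e ∈ A x}) {M : (Γ × Fin d → ℝ) → Set Γ}
    (hM : ∀ g x v, g * v ∈ M (shiftE g x) ↔ v ∈ M x) (hMm : ∀ v, MeasurableSet {x | v ∈ M x})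
    (hhit : ∀ᵐ x ∂P, ∃ w ∈ M x, ConnIn S (A x) 1 w) :
    1 ≤ P {x | 1 ∈ M x} + ∑ i, P {x | (1, i) ∈ A x} := by
  let T : Γ × Fin d → Γ → Γ → Set (Γ × Fin d → ℝ) := fun e u v =>
    {x | e ∈ A x ∧ ∃ k, u ∈ nbhd S (A x) (M x) k ∧ v ∉ nbhd S (A x) (M x) k}
  have hTm : ∀ e u v, MeasurableSet (T e u v) := fun e u v => by
    have : T e u v = {x | e ∈ A x} ∩ ⋃ k, {x | u ∈ nbhd S (A x) (M x) k} ∩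
        {x | v ∈ nbhd S (A x) (M x) k}ᶜ := by
      ext x; simp [T]
    rw [this]
    exact (hAm e).inter <| MeasurableSet.iUnion fun k =>
      (measurableSet_mem_nbhd S hAm hMm k u).inter (measurableSet_mem_nbhd S hAm hMm k v).compl
  have hTs : ∀ g e u v, P (T (g * e.1, e.2) (g * u) (g * v)) = P (T e u v) := fun g e u v => by
    rw [← (hinv g).measure_preimage (hTm _ _ _).nullMeasurableSet]
    congr 1
    ext x
    simp only [T, Set.mem_preimage, Set.mem_ofPred_eq, hA g x e,
      mul_mem_nbhd_iff S g (hA g x) (hM g x)]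
  have hcover : ∀ᵐ x ∂P, x ∈ {x | 1 ∈ M x} ∪
      ⋃ i, (T (1, i) (S i) 1 ∪ T ((S i)⁻¹, i) (S i)⁻¹ 1) := by
    filter_upwards [hhit] with x ⟨w, hw, hc⟩
    by_cases h1 : (1 : Γ) ∈ M x
    · exact Or.inl h1
    right
    classical
    have hex := exists_mem_nbhd hc hw
    have hk := Nat.find_spec hex
    have hmin := fun m => Nat.find_min hex (m := m)
    generalize Nat.find hex = k at hk hmin
    cases k with
    | zero => exact absurd hk h1
    | succ k =>
      have hk' := hmin k (Nat.lt_succ_self k)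
      rcases hk with hk | ⟨e, he, w, hJ, hw⟩
      · exact absurd hk hk'
      · obtain ⟨g, i⟩ := e
        refine Set.mem_iUnion.2 ⟨i, ?_⟩
        rcases hJ with ⟨h, h'⟩ | ⟨h, h'⟩
        · simp only at h h'
          subst h
          rw [one_mul] at h'
          exact Or.inl ⟨he, k, h' ▸ hw, hk'⟩
        · simp only at h h'
          have hg : g = (S i)⁻¹ := eq_inv_of_mul_eq_one_left h'.symm
          subst hg
          exact Or.inr ⟨he, k, h ▸ hw, hk'⟩
  calc (1 : ENNReal) = P univ := measure_univ.symm
    _ ≤ P ({x | 1 ∈ M x} ∪ ⋃ i, (T (1, i) (S i) 1 ∪ T ((S i)⁻¹, i) (S i)⁻¹ 1)) :=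
        measure_mono_ae (by filter_upwards [hcover] with x hx _ using hx)
    _ ≤ P {x | 1 ∈ M x} + ∑ i, (P (T (1, i) (S i) 1) + P (T ((S i)⁻¹, i) (S i)⁻¹ 1)) := by
        refine (measure_union_le _ _).trans (add_le_add le_rfl ?_)
        exact (measure_iUnion_fintype_le _ _).trans
          (Finset.sum_le_sum fun i _ => measure_union_le _ _)
    _ ≤ P {x | 1 ∈ M x} + ∑ i, P {x | (1, i) ∈ A x} := by
        refine add_le_add le_rfl (Finset.sum_le_sum fun i _ => ?_)
        have h1 := hTs (S i)⁻¹ (1, i) 1 (S i)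
        simp only [mul_one, inv_mul_cancel] at h1
        rw [h1, ← measure_union _ (hTm _ _ _)]
        · exact measure_mono (Set.union_subset (fun x hx => hx.1) fun x hx => hx.1)
        · rw [Set.disjoint_left]
          rintro x ⟨-, k, h2, h3⟩ ⟨-, l, h4, h5⟩
          rcases le_total k l with h | h
          · exact h5 (nbhd_mono S _ _ h h2)
          · exact h3 (nbhd_mono S _ _ h h4)

/-- An invariant random graph with infinite clusters has on average at least one edge per
vertex. -/
lemma one_le_sum_of_infinite_clusters (hP : IsProductLeb P)
    (S : Fin d → Γ) {A : (Γ × Fin d → ℝ) → Set (Γ × Fin d)} (hA : Equivariant A)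
    (hAm : ∀ e, MeasurableSet {x | e ∈ A x}) (i₀ : Fin d)
    (hinf : ∀ x v, {w | ConnIn S (A x) v w}.Infinite) :
    1 ≤ ∑ i, P {x | (1, i) ∈ A x} := by
  have := hP.1
  have hinv := hP.measurePreserving_shiftE
  have hCm := measurableSet_connIn S hAm
  let N : ℝ → (Γ × Fin d → ℝ) → Set Γ := fun ε x =>
    {v | ∀ w, ConnIn S (A x) v w → x (v, i₀) ≤ x (w, i₀) + ε}
  have hNs : ∀ ε g x v, g * v ∈ N ε (shiftE g x) ↔ v ∈ N ε x := by
    intro ε g x v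
    constructor
    · intro h w hw
      simpa [shiftE] using h (g * w) ((hA.connIn_iff g x v w).2 hw)
    · intro h w hw
      have h1 : ConnIn S (A x) v (g⁻¹ * w) := by
        rw [← hA.connIn_iff g]; simpa using hw
      simpa [shiftE] using h _ h1
  have hNm : ∀ ε v, MeasurableSet {x | v ∈ N ε x} := fun ε v => by
    have : {x | v ∈ N ε x} = ⋂ w, {x | ConnIn S (A x) v w → x (v, i₀) ≤ x (w, i₀) + ε} := by
      ext x; simp [N]
    rw [this]
    exact MeasurableSet.iInter fun w => (hCm v w).imp <|
      measurableSet_le (by fun_prop) (by fun_prop)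
  have hzero : P {x | 1 ∈ N 0 x} = 0 := by
    classical
    let φ : Γ → (Γ × Fin d → ℝ) → ENNReal := fun g =>
      ({x | g ∈ N 0 x} ∩ {x | ConnIn S (A x) 1 g}).indicator 1
    have hφ : ∀ g, Measurable (φ g) := fun g =>
      measurable_one.indicator ((hNm 0 g).inter (hCm 1 g))
    have hle : ∫⁻ x, ∑' g, φ g x ∂P ≤ 1 := by
      calc ∫⁻ x, ∑' g, φ g x ∂P ≤ ∫⁻ _, 1 ∂P := by
            refine lintegral_mono_ae ?_
            filter_upwards [hP.ae_injective] with x hx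
            by_cases h : ∃ v, v ∈ N 0 x ∧ ConnIn S (A x) 1 v
            · obtain ⟨v, hv, hc⟩ := h
              rw [tsum_eq_single v]
              · exact Set.indicator_le_self' (fun _ _ => zero_le) x
              · intro w hw
                refine Set.indicator_of_notMem ?_ _
                rintro ⟨h1, h2⟩
                have h3 := h1 v (h2.symm.trans hc)
                have h4 := hv w (hc.symm.trans h2)
                simp only [add_zero] at h3 h4
                exact hw (Prod.ext_iff.1 (hx (le_antisymm h3 h4))).1
            · have h0 : ∀ g, φ g x = 0 := fun g => by
                have hg : x ∉ {x | g ∈ N 0 x} ∩ {x | ConnIn S (A x) 1 g} := fun hg => h ⟨g, hg⟩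
                simp only [φ, Set.indicator_of_notMem hg]
              simp [h0]
        _ = 1 := by simp
    rw [mass_transport hinv hφ] at hle
    have hge : ∫⁻ x, {x | 1 ∈ N 0 x}.indicator (fun _ => ⊤) x ∂P ≤ 1 := by
      refine (lintegral_mono fun x => ?_).trans hle
      by_cases hx : x ∈ {x | 1 ∈ N 0 x}
      · rw [Set.indicator_of_mem hx]
        have hval : ∀ g ∈ {w | ConnIn S (A x) 1 w}, φ g⁻¹ (shiftE g⁻¹ x) = 1 := fun g hg => by
          have h1 := (hNs 0 g⁻¹ x 1).2 hx
          have h2 := (hA.connIn_iff g⁻¹ x g 1).2 (ConnIn.symm hg)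
          rw [mul_one] at h1 h2
          rw [inv_mul_cancel] at h2
          have h3 : shiftE g⁻¹ x ∈ {x | g⁻¹ ∈ N 0 x} ∩ {x | ConnIn S (A x) 1 g⁻¹} := ⟨h1, h2⟩
          simp only [φ, Set.indicator_of_mem h3, Pi.one_apply]
        have hinf1 : Infinite {w | ConnIn S (A x) 1 w} := (hinf x 1).to_subtype
        calc ⊤ = ∑' _ : {w | ConnIn S (A x) 1 w}, (1 : ENNReal) :=
              (ENNReal.tsum_const_eq_top_of_ne_zero one_ne_zero).symm
          _ = ∑' g : {w | ConnIn S (A x) 1 w}, φ (g : Γ)⁻¹ (shiftE (g : Γ)⁻¹ x) :=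
              tsum_congr fun g => (hval g g.2).symm
          _ ≤ _ := ENNReal.tsum_comp_le_tsum_of_injective Subtype.val_injective
              fun g : Γ => φ g⁻¹ (shiftE g⁻¹ x)
      · rw [Set.indicator_of_notMem hx]
        exact zero_le
    rw [lintegral_indicator_const (hNm 0 1)] at hge
    by_contra hne
    rw [ENNReal.top_mul hne] at hge
    simp at hge
  have hbound : ∀ n : ℕ, 1 ≤ P {x | 1 ∈ N (1 / ((n : ℝ) + 1)) x} + ∑ i, P {x | (1, i) ∈ A x} := by
    intro n
    refine one_le_measure_add_sum hinv S hA hAm (hNs _) (hNm _) ?_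
    have hIcc : ∀ᵐ x ∂P, ∀ e, x e ∈ Icc (0 : ℝ) 1 := ae_all_iff.2 hP.ae_mem_Icc
    filter_upwards [hIcc] with x hx
    let U : Set ℝ := (fun w => x (w, i₀)) '' {w | ConnIn S (A x) 1 w}
    have hU : U.Nonempty := ⟨_, 1, Relation.ReflTransGen.refl, rfl⟩
    have hUb : BddBelow U := ⟨0, by rintro _ ⟨w, -, rfl⟩; exact (hx _).1⟩
    obtain ⟨_, ⟨w, hw, rfl⟩, hlt⟩ := exists_lt_of_csInf_lt hU
      (lt_add_of_pos_right (sInf U) (Nat.one_div_pos_of_nat (α := ℝ) (n := n)))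
    refine ⟨w, fun v hv => hlt.le.trans (add_le_add ?_ le_rfl), hw⟩
    exact csInf_le hUb ⟨v, Relation.ReflTransGen.trans hw hv, rfl⟩
  have hlim : Filter.Tendsto (fun n : ℕ => P {x | 1 ∈ N (1 / ((n : ℝ) + 1)) x}) Filter.atTop
      (nhds 0) := by
    have hInter : ⋂ n : ℕ, {x | 1 ∈ N (1 / ((n : ℝ) + 1)) x} = {x | 1 ∈ N 0 x} := by
      ext x
      simp only [Set.mem_iInter]
      constructor
      · intro h w hw
        have h1 : Filter.Tendsto (fun n : ℕ => x (w, i₀) + 1 / ((n : ℝ) + 1)) Filter.atTop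
            (nhds (x (w, i₀) + 0)) := tendsto_one_div_add_atTop_nhds_zero_nat.const_add _
        exact ge_of_tendsto' h1 fun n => h n w hw
      · intro h n w hw
        have := h w hw
        have h2 := (Nat.one_div_pos_of_nat (α := ℝ) (n := n)).le
        linarith
    have := tendsto_measure_iInter_atTop (μ := P)
      (s := fun n : ℕ => {x | 1 ∈ N (1 / ((n : ℝ) + 1)) x})
      (fun n => (hNm _ _).nullMeasurableSet)
      (fun m n hmn x hx w hw => (hx w hw).trans
        (add_le_add le_rfl (Nat.one_div_le_one_div hmn)))
      ⟨0, measure_ne_top _ _⟩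
    rwa [hInter, hzero] at this
  have := hlim.add_const (∑ i, P {x | (1, i) ∈ A x})
  rw [zero_add] at this
  exact ge_of_tendsto' this hbound

end MassTransport

section Hyperfinite

variable [Countable Γ] {P : Measure (Γ × Fin d → ℝ)}

/-- Inside the classes of a finite equivalence relation a forest has on average at most one edge
per vertex. -/
lemma sum_le_one_of_finite_classes [IsProbabilityMeasure P]
    (hinv : ∀ g : Γ, MeasurePreserving (shiftE g) P P) (S : Fin d → Γ)
    {A : (Γ × Fin d → ℝ) → Set (Γ × Fin d)} (hA : Equivariant A)
    (hAm : ∀ e, MeasurableSet {x | e ∈ A x})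
    (hforest : ∀ᵐ x ∂P, ∀ (K : Finset Γ) (D : Finset (Γ × Fin d)),
      (∀ e ∈ D, e ∈ A x ∧ e.1 ∈ K ∧ e.1 * S e.2 ∈ K) → D.card ≤ K.card)
    (hfree : ∀ᵐ x ∂P, Function.Injective fun g : Γ => shiftE g⁻¹ x)
    {R : Set ((Γ × Fin d → ℝ) × (Γ × Fin d → ℝ))} (hR : IsEquivRelSet R)
    (hRm : MeasurableSet R) (hRfin : ∀ x, {y | (x, y) ∈ R}.Finite) :
    ∑ i, P {x | (1, i) ∈ A x ∧ (x, shiftE (S i)⁻¹ x) ∈ R} ≤ 1 := by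
  classical
  obtain ⟨hrefl, hsymm, htrans⟩ := hR
  let K : (Γ × Fin d → ℝ) → Set Γ := fun x => {g | (x, shiftE g⁻¹ x) ∈ R}
  have hKm : ∀ g, MeasurableSet {x | g ∈ K x} := fun g =>
    (measurable_id.prodMk (measurable_shiftE g⁻¹)) hRm
  have hKs : ∀ x u g, u ∈ K x → (g ∈ K (shiftE u⁻¹ x) ↔ u * g ∈ K x) := by
    intro x u g hu
    have : shiftE g⁻¹ (shiftE u⁻¹ x) = shiftE (u * g)⁻¹ x := by
      rw [shiftE_shiftE, mul_inv_rev]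
    simp only [K, Set.mem_ofPred_eq, this]
    exact ⟨fun h => htrans _ _ _ hu h, fun h => htrans _ _ _ (hsymm _ _ hu) h⟩
  have hKinv : ∀ x u, u⁻¹ ∈ K (shiftE u⁻¹ x) ↔ u ∈ K x := by
    intro x u
    simp only [K, Set.mem_ofPred_eq, shiftE_shiftE, inv_inv, mul_inv_cancel, shiftE_one]
    exact ⟨hsymm _ _, hsymm _ _⟩
  have hK1 : ∀ x, (1 : Γ) ∈ K x := fun x => by
    simp only [K, Set.mem_ofPred_eq, inv_one, shiftE_one]
    exact hrefl x
  have hKfin : ∀ᵐ x ∂P, (K x).Finite := by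
    filter_upwards [hfree] with x hx
    exact (hRfin x).preimage (f := fun g : Γ => shiftE g⁻¹ x) hx.injOn
  let E : Fin d → Set (Γ × Fin d → ℝ) := fun i => {x | (1, i) ∈ A x ∧ S i ∈ K x}
  have hEm : ∀ i, MeasurableSet (E i) := fun i => (hAm _).inter (hKm _)
  let N : (Γ × Fin d → ℝ) → ENNReal := fun x => ∑ i, (E i).indicator 1 x
  have hNm : Measurable N :=
    Finset.measurable_sum _ fun i _ => measurable_one.indicator (hEm i)
  let κ : (Γ × Fin d → ℝ) → ENNReal := fun x => ∑' g, {x | g ∈ K x}.indicator 1 x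
  have hκm : Measurable κ := Measurable.tsum fun g => measurable_one.indicator (hKm g)
  have hκ : ∀ x (h : (K x).Finite), κ x = h.toFinset.card := by
    intro x h
    have h0 : ∀ g ∉ h.toFinset, {x | g ∈ K x}.indicator (1 : (Γ × Fin d → ℝ) → ENNReal) x = 0 :=
        fun g hg =>
      Set.indicator_of_notMem
        (show x ∉ {x | g ∈ K x} from fun hx => hg (h.mem_toFinset.2 hx)) _
    simp only [κ]
    rw [tsum_eq_sum h0, Finset.card_eq_sum_ones, Nat.cast_sum]
    exact Finset.sum_congr rfl fun g hg => by
      rw [Set.indicator_of_mem (show x ∈ {x | g ∈ K x} from h.mem_toFinset.1 hg)]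
      simp
  have hκ0 : ∀ x (h : (K x).Finite), κ x ≠ 0 := fun x h => by
    rw [hκ x h]
    have : h.toFinset.card ≠ 0 := Finset.card_ne_zero_of_mem (h.mem_toFinset.2 (hK1 x))
    exact_mod_cast this
  have hκs : ∀ x u, u ∈ K x → κ (shiftE u⁻¹ x) = κ x := by
    intro x u hu
    simp only [κ]
    rw [← (Equiv.mulLeft u).tsum_eq
      (fun g => {x | g ∈ K x}.indicator (1 : (Γ × Fin d → ℝ) → ENNReal) x)]
    refine tsum_congr fun g => ?_
    simp only [Set.indicator_apply, Set.mem_ofPred_eq, hKs x u g hu, Equiv.coe_mulLeft]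
    rfl
  let φ : Γ → (Γ × Fin d → ℝ) → ENNReal := fun g x =>
    {x | g ∈ K x}.indicator 1 x * (N x * (κ x)⁻¹)
  have hφ : ∀ g, Measurable (φ g) := fun g =>
    (measurable_one.indicator (hKm g)).mul (hNm.mul hκm.inv)
  have hout : ∫⁻ x, ∑' g, φ g x ∂P = ∑ i, P (E i) := by
    calc ∫⁻ x, ∑' g, φ g x ∂P = ∫⁻ x, N x ∂P := by
          refine lintegral_congr_ae ?_
          filter_upwards [hKfin] with x hx
          simp only [φ]
          rw [ENNReal.tsum_mul_right]
          change κ x * (N x * (κ x)⁻¹) = N x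
          rw [mul_left_comm, ENNReal.mul_inv_cancel (hκ0 x hx) (by simp [hκ x hx]), mul_one]
      _ = ∑ i, P (E i) := by
          simp only [N]
          rw [lintegral_finsetSum _ fun i _ => measurable_one.indicator (hEm i)]
          exact Finset.sum_congr rfl fun i _ => lintegral_indicator_one (hEm i)
  have hin : ∫⁻ x, ∑' g, φ g⁻¹ (shiftE g⁻¹ x) ∂P ≤ 1 := by
    calc ∫⁻ x, ∑' g, φ g⁻¹ (shiftE g⁻¹ x) ∂P ≤ ∫⁻ _, 1 ∂P := by
          refine lintegral_mono_ae ?_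
          filter_upwards [hKfin, hforest] with x hx hF
          set T := hx.toFinset with hT
          have hTmem : ∀ g, g ∈ T ↔ g ∈ K x := fun g => hx.mem_toFinset
          have h0 : ∀ g ∉ T, φ g⁻¹ (shiftE g⁻¹ x) = 0 := fun g hg => by
            have h1 : shiftE g⁻¹ x ∉ {x | g⁻¹ ∈ K x} := fun h =>
              hg ((hTmem g).2 ((hKinv x g).1 h))
            simp only [φ, Set.indicator_of_notMem h1, zero_mul]
          have hN : ∀ g ∈ T, N (shiftE g⁻¹ x) =
              ∑ i, if (g, i) ∈ A x ∧ g * S i ∈ T then (1 : ENNReal) else 0 := fun g hg => by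
            refine Finset.sum_congr rfl fun i _ => ?_
            have h1 : ((1 : Γ), i) ∈ A (shiftE g⁻¹ x) ↔ (g, i) ∈ A x := by
              simpa using hA g⁻¹ x (g, i)
            simp only [Set.indicator_apply, E, Set.mem_ofPred_eq, h1,
              hKs x g (S i) ((hTmem g).1 hg), hTmem, Pi.one_apply]
          have h1 : ∀ g ∈ T, φ g⁻¹ (shiftE g⁻¹ x) =
              (∑ i, if (g, i) ∈ A x ∧ g * S i ∈ T then (1 : ENNReal) else 0) * (κ x)⁻¹ :=
            fun g hg => by
              have h2 : shiftE g⁻¹ x ∈ {x | g⁻¹ ∈ K x} := (hKinv x g).2 ((hTmem g).1 hg)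
              simp only [φ, Set.indicator_of_mem h2, Pi.one_apply, one_mul, hN g hg,
                hκs x g ((hTmem g).1 hg)]
          rw [tsum_eq_sum h0, Finset.sum_congr rfl h1, ← Finset.sum_mul, ← Finset.sum_product']
          have hcard := hF T ((T ×ˢ Finset.univ).filter
            fun e : Γ × Fin d => e ∈ A x ∧ e.1 * S e.2 ∈ T) fun e he => by
              simp only [Finset.mem_filter, Finset.mem_product] at he
              exact ⟨he.2.1, he.1.1, he.2.2⟩
          rw [Finset.sum_boole, hκ x hx]
          calc _ ≤ (T.card : ENNReal) * (T.card : ENNReal)⁻¹ := by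
                refine mul_le_mul_left ?_ _
                exact_mod_cast hcard
            _ ≤ 1 := ENNReal.mul_inv_le_one _
      _ = 1 := by simp
  rw [mass_transport hinv hφ] at hout
  exact hout ▸ hin

end Hyperfinite

/-- If `WMSF ≠ FMSF` (an edge lies in the free but not the wired minimal spanning forest with
positive probability), then the cluster equivalence relation `R_FMSF` of the free minimal
spanning forest is not hyperfinite. -/
theorem rfmsf_not_hyperfinite (Γ : Type) [Group Γ] [Infinite Γ] (d : ℕ)
    (S : Fin d → Γ) (hgen : Subgroup.closure (Set.range S) = ⊤)
    (P : Measure ((Γ × Fin d) → ℝ)) (hP : IsProductLeb P)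
    (hne : ∃ e : Γ × Fin d, 0 < P {x | e ∈ FMSF S x ∧ e ∉ WMSF S x}) :
    ¬ Hyperfinite (Rfmsf S) := by
  rintro ⟨Rn, hmono, hRn, hunion⟩
  have : Countable Γ := by
    have : Countable (FreeGroup (Fin d)) := inferInstanceAs (Countable (Quot _))
    exact (FreeGroup.lift_surjective_iff_closure_range_eq_top.2 hgen).countable
  have := hP.1
  have hinv := hP.measurePreserving_shiftE
  obtain ⟨⟨g₀, i₀⟩, hpos⟩ := hne
  let D : Fin d → Set (Γ × Fin d → ℝ) := fun i =>
    {x | (1, i) ∈ freeForest S x ∧ (1, i) ∉ wiredForest S x}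
  have hDpos : 0 < P (D i₀) := by
    have hm : MeasurableSet (D i₀) :=
      (measurableSet_mem_freeForest S _).inter (measurableSet_mem_wiredForest S _).compl
    rw [← (hinv g₀⁻¹).measure_preimage hm.nullMeasurableSet]
    refine hpos.trans_le (measure_mono_ae ?_)
    filter_upwards [hP.ae_injective] with x hx ⟨hF, hW⟩
    have h1 := equivariant_freeForest S g₀⁻¹ x (g₀, i₀)
    have h2 := equivariant_wiredForest S g₀⁻¹ x (g₀, i₀)
    rw [inv_mul_cancel] at h1 h2
    exact ⟨h1.2 (FMSF_subset_freeForest S x hF), fun h => not_mem_wiredForest S hx hF hW (h2.1 h)⟩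
  have hlower : 1 + P (D i₀) ≤ ∑ i, P {x | (1, i) ∈ freeForest S x} := by
    have hW := one_le_sum_of_infinite_clusters hP S (equivariant_wiredForest S)
      (measurableSet_mem_wiredForest S) i₀ (infinite_cluster_wiredForest hgen)
    have hsplit : ∀ i, P {x | (1, i) ∈ freeForest S x} =
        P {x | (1, i) ∈ wiredForest S x} + P (D i) := fun i => by
      rw [← measure_inter_add_sdiff {x | (1, i) ∈ freeForest S x}
        (measurableSet_mem_wiredForest S (1, i))]
      congr 2
      ext x
      exact ⟨fun h => h.2, fun h => ⟨h.1, h⟩⟩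
    simp only [hsplit, Finset.sum_add_distrib]
    exact add_le_add hW (Finset.single_le_sum (f := fun i => P (D i)) (fun _ _ => zero_le)
      (Finset.mem_univ i₀))
  have hfree : ∀ᵐ x ∂P, Function.Injective fun g : Γ => shiftE g⁻¹ x := by
    filter_upwards [hP.ae_injective] with x hx g h hgh
    have := congrFun hgh (1, i₀)
    simp only [shiftE, inv_inv, mul_one] at this
    exact (Prod.ext_iff.1 (hx this)).1
  have hupper_n : ∀ n, ∑ i, P {x | (1, i) ∈ freeForest S x ∧ (x, shiftE (S i)⁻¹ x) ∈ Rn n} ≤ 1 :=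
    fun n => by
      refine sum_le_one_of_finite_classes hinv S (equivariant_freeForest S)
        (measurableSet_mem_freeForest S) ?_ hfree (hRn n).1 (hRn n).2.1 (hRn n).2.2
      filter_upwards [hP.ae_injective] with x hx
      exact card_le_of_subset_freeForest hx
  have hlim : ∀ i, Filter.Tendsto
      (fun n => P {x | (1, i) ∈ freeForest S x ∧ (x, shiftE (S i)⁻¹ x) ∈ Rn n}) Filter.atTop
      (nhds (P {x | (1, i) ∈ freeForest S x})) := fun i => by
    have h1 := tendsto_measure_iUnion_atTop (μ := P)
      (s := fun n => {x | (1, i) ∈ freeForest S x ∧ (x, shiftE (S i)⁻¹ x) ∈ Rn n})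
      fun m n hmn x hx => ⟨hx.1, hmono hmn hx.2⟩
    suffices h2 : P {x | (1, i) ∈ freeForest S x} =
        P (⋃ n, {x | (1, i) ∈ freeForest S x ∧ (x, shiftE (S i)⁻¹ x) ∈ Rn n}) by
      rw [h2]
      exact h1
    refine measure_congr (Filter.eventuallyEq_set.2 ?_)
    filter_upwards [hP.ae_injective] with x hx
    refine ⟨fun h => ?_, fun h => ?_⟩
    · have h3 : (x, shiftE (S i)⁻¹ x) ∈ Rfmsf S :=
        ⟨S i, rfl, ConnIn.of_joins (e := (1, i)) (freeForest_subset_FMSF S hx h)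
          (Or.inl ⟨rfl, (one_mul _).symm⟩)⟩
      rw [hunion] at h3
      obtain ⟨n, hn⟩ := Set.mem_iUnion.1 h3
      exact Set.mem_iUnion.2 ⟨n, h, hn⟩
    · obtain ⟨n, hn⟩ := Set.mem_iUnion.1 h
      exact hn.1
  have hupper : ∑ i, P {x | (1, i) ∈ freeForest S x} ≤ 1 :=
    le_of_tendsto' (tendsto_finsetSum _ fun i _ => hlim i) hupper_n
  have hcontra := hlower.trans hupper
  exact absurd hcontra (not_le.2 (ENNReal.lt_add_right ENNReal.one_ne_top hDpos.ne'))

end
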